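/- Let d, n ≥ 1, λ > 0, let X₁, …, X_n ∈ ℝ^d be fixed points, and let {T_{j,0}, T_{j,1}}_{j=1,…,d} be 2d i.i.d. exponential random variables with rate λ. For every x ∈ ℝ^d such that x_j ≠ X_i^{(j)} for all i ∈ {1,…,n} and j ∈ {1,…,d}, the ideal (infinite) Mondrian forest density estimator satisfies (1/n) ∑_{i=1}^n E[ 1{∀j: −T_{j,0} ≤ x_j − X_i^{(j)} ≤ T_{j,1}} / ∏_{j=1}^d (T_{j,0} + T_{j,1}) ] = (λ^d/n) ∑_{i=1}^n exp(−λ‖x − X_i‖₁) ∏_{j=1}^d h(λ|x_j − X_i^{(j)}|), where h(r) := 1 − r e^{r} E₁(r). -/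

import Mathlib

open MeasureTheory ProbabilityTheory
open scoped Classical

/-- The exponential integral `E₁(r) = ∫_r^∞ e^{-s}/s ds`. -/
noncomputable def E1 (r : ℝ) : ℝ := ∫ s in Set.Ioi r, Real.exp (-s) / s

/-- `h(r) = 1 - r e^r E₁(r)`, the volume-correction factor of the Mondrian
forest kernel. -/
noncomputable def hker (r : ℝ) : ℝ := 1 - r * Real.exp r * E1 r

lemma integrableOn_exp_neg_div {r : ℝ} (hr : 0 < r) :
    IntegrableOn (fun s => Real.exp (-s) / s) (Set.Ioi r) := by
  refine Integrable.mono' ((integrableOn_exp_neg_Ioi r).div_const r)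
    (Measurable.aestronglyMeasurable (by fun_prop)) ?_
  filter_upwards [ae_restrict_mem measurableSet_Ioi] with s hs
  have hs' : r < s := hs
  rw [Real.norm_of_nonneg (by have := hr.trans hs'; positivity)]
  gcongr

lemma E1_nonneg {r : ℝ} (hr : 0 < r) : 0 ≤ E1 r := by
  refine setIntegral_nonneg measurableSet_Ioi fun s hs => ?_
  have := hr.trans (Set.mem_Ioi.1 hs)
  positivity

lemma mul_E1_le_exp_neg {r : ℝ} (hr : 0 < r) : r * E1 r ≤ Real.exp (-r) := by
  rw [← integral_exp_neg_Ioi r, E1, ← integral_const_mul]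
  refine setIntegral_mono_on ((integrableOn_exp_neg_div hr).const_mul r)
    (integrableOn_exp_neg_Ioi r) measurableSet_Ioi fun s hs => ?_
  have hs' : r < s := hs
  have := hr.trans hs'
  rw [mul_div_assoc', div_le_iff₀ this, mul_comm]
  gcongr

lemma hasDerivAt_E1 {r : ℝ} (hr : 0 < r) : HasDerivAt E1 (-(Real.exp (-r) / r)) r := by
  have hint : IntervalIntegrable (fun s => Real.exp (-s) / s) volume (r / 2) r := by
    refine (intervalIntegrable_iff_integrableOn_Ioc_of_le (by linarith)).2 ?_
    exact (integrableOn_exp_neg_div (half_pos hr)).mono_set Set.Ioc_subset_Ioi_self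
  have hd := intervalIntegral.integral_hasDerivAt_right hint
    (Measurable.stronglyMeasurable (by fun_prop)).stronglyMeasurableAtFilter
    (ContinuousAt.div (by fun_prop) continuousAt_id hr.ne')
  refine (hd.const_sub (E1 (r / 2))).congr_of_eventuallyEq ?_
  filter_upwards [lt_mem_nhds hr] with t ht
  have := intervalIntegral.integral_Ioi_sub_Ioi' (integrableOn_exp_neg_div (half_pos hr))
    (integrableOn_exp_neg_div ht)
  rw [← this]
  simp [E1]

lemma tendsto_mul_E1_atTop : Filter.Tendsto (fun r => r * E1 r) Filter.atTop (nhds 0) := by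
  refine tendsto_of_tendsto_of_tendsto_of_le_of_le' tendsto_const_nhds
    (Real.tendsto_exp_neg_atTop_nhds_zero) ?_ ?_
  · filter_upwards [Filter.eventually_gt_atTop 0] with r hr using mul_nonneg hr.le (E1_nonneg hr)
  · filter_upwards [Filter.eventually_gt_atTop 0] with r hr using mul_E1_le_exp_neg hr

lemma tendsto_E1_atTop : Filter.Tendsto E1 Filter.atTop (nhds 0) := by
  refine tendsto_of_tendsto_of_tendsto_of_le_of_le' tendsto_const_nhds
    tendsto_mul_E1_atTop ?_ ?_
  · filter_upwards [Filter.eventually_gt_atTop 0] with r hr using E1_nonneg hr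
  · filter_upwards [Filter.eventually_ge_atTop 1] with r hr
    exact le_mul_of_one_le_left (E1_nonneg (by linarith)) hr

lemma tendsto_mul_const_add_atTop {lam : ℝ} (hlam : 0 < lam) (c : ℝ) :
    Filter.Tendsto (fun t : ℝ => lam * (c + t)) Filter.atTop Filter.atTop :=
  (Filter.tendsto_atTop_add_const_left _ _ Filter.tendsto_id).const_mul_atTop hlam

lemma hasDerivAt_mul_const_add (lam c t : ℝ) :
    HasDerivAt (fun t : ℝ => lam * (c + t)) lam t := by
  simpa using ((hasDerivAt_id t).const_add c).const_mul lam

lemma integral_Ioi_exp_mul_inv_add {lam a u : ℝ} (hlam : 0 < lam) (ha : 0 ≤ a) (hu : 0 < u) :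
    ∫ b in Set.Ioi u, lam * Real.exp (-(lam * b)) * (a + b)⁻¹
      = lam * Real.exp (lam * a) * E1 (lam * (a + u)) := by
  have key := integral_Ioi_of_hasDerivAt_of_nonneg' (a := u) (l := 0)
    (g := fun b => -(lam * Real.exp (lam * a)) * E1 (lam * (a + b)))
    (g' := fun b => lam * Real.exp (-(lam * b)) * (a + b)⁻¹) ?_ ?_ ?_
  · rw [key]; ring
  · intro b hb
    have hb' : 0 < a + b := by have := hu.trans_le (Set.mem_Ici.1 hb); linarith
    have := ((hasDerivAt_E1 (mul_pos hlam hb')).comp b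
      (hasDerivAt_mul_const_add lam a b)).const_mul (-(lam * Real.exp (lam * a)))
    refine this.congr_deriv ?_
    rw [show -(lam * b) = lam * a + -(lam * (a + b)) by ring, Real.exp_add]
    field_simp
  · intro b hb
    have := hu.trans (Set.mem_Ioi.1 hb)
    positivity
  · simpa using (tendsto_E1_atTop.comp (tendsto_mul_const_add_atTop hlam a)).const_mul
      (-(lam * Real.exp (lam * a)))

lemma integral_Ioi_E1 {lam u : ℝ} (hlam : 0 < lam) (hu : 0 < u) :
    ∫ a in Set.Ioi 0, lam * E1 (lam * (u + a)) = Real.exp (-(lam * u)) * hker (lam * u) := by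
  have key := integral_Ioi_of_hasDerivAt_of_nonneg' (a := 0) (l := 0)
    (g := fun a => lam * (u + a) * E1 (lam * (u + a)) - Real.exp (-(lam * (u + a))))
    (g' := fun a => lam * E1 (lam * (u + a))) ?_ ?_ ?_
  · rw [key, hker, add_zero]
    have : Real.exp (-(lam * u)) * Real.exp (lam * u) = 1 := by rw [← Real.exp_add]; simp
    linear_combination lam * u * E1 (lam * u) * this
  · intro a ha
    have ha' : 0 < u + a := by have := Set.mem_Ici.1 ha; linarith
    have hm := hasDerivAt_mul_const_add lam u a
    have := (hm.mul ((hasDerivAt_E1 (mul_pos hlam ha')).comp a hm)).sub hm.neg.exp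
    refine this.congr_deriv ?_
    simp only [Function.comp, Pi.neg_apply]
    field_simp
    ring
  · intro a ha
    have := Set.mem_Ioi.1 ha
    exact mul_nonneg hlam.le (E1_nonneg (by positivity))
  · simpa [Function.comp_def] using (tendsto_mul_E1_atTop.sub Real.tendsto_exp_neg_atTop_nhds_zero).comp
      (tendsto_mul_const_add_atTop hlam u)

lemma integral_expMeasure {lam : ℝ} (hlam : 0 < lam) (f : ℝ → ℝ) :
    ∫ t, f t ∂(expMeasure lam) = ∫ t in Set.Ioi 0, lam * Real.exp (-(lam * t)) * f t := by
  rw [expMeasure, gammaMeasure, integral_withDensity_eq_integral_toReal_smul (f := gammaPDF 1 lam)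
    (measurable_gammaPDFReal 1 lam).ennreal_ofReal (by simp [gammaPDF]),
    ← integral_Ici_eq_integral_Ioi, ← integral_indicator measurableSet_Ici]
  congr with t
  by_cases ht : 0 ≤ t
  · rw [Set.indicator_of_mem (Set.mem_Ici.2 ht), gammaPDF_of_nonneg ht,
      ENNReal.toReal_ofReal (by simp; positivity)]
    simp
  · rw [Set.indicator_of_notMem (by simpa using ht), gammaPDF_of_neg (by simpa using ht)]
    simp

lemma ae_pos_expMeasure (lam : ℝ) : ∀ᵐ t ∂(expMeasure lam), 0 < t := by
  refine (ae_withDensity_iff (measurable_gammaPDFReal 1 lam).ennreal_ofReal).2 ?_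
  filter_upwards [compl_mem_ae_iff.2 (measure_singleton (0 : ℝ))] with t ht h
  by_contra hneg
  exact h (gammaPDF_of_neg (lt_of_le_of_ne (not_lt.1 hneg) ht))

/-- The one-dimensional weight: the inverse length of `[-p.1, p.2]` if it contains `u`. -/
noncomputable def cellWeight (u : ℝ) (p : ℝ × ℝ) : ℝ :=
  if -p.1 ≤ u ∧ u ≤ p.2 then (p.1 + p.2)⁻¹ else 0

lemma measurable_cellWeight (u : ℝ) : Measurable (cellWeight u) := by
  refine Measurable.ite ?_ (by fun_prop) measurable_const
  exact (measurableSet_le measurable_fst.neg measurable_const).inter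
    (measurableSet_le measurable_const measurable_snd)

lemma integral_cellWeight_of_pos {lam u : ℝ} (hlam : 0 < lam) (hu : 0 < u) :
    ∫ p, cellWeight u p ∂((expMeasure lam).prod (expMeasure lam))
      = lam * (Real.exp (-(lam * u)) * hker (lam * u)) := by
  have := isProbabilityMeasure_expMeasure hlam
  have hint : Integrable (cellWeight u) ((expMeasure lam).prod (expMeasure lam)) := by
    refine Integrable.of_bound (measurable_cellWeight u).aestronglyMeasurable u⁻¹ ?_
    filter_upwards [Measure.quasiMeasurePreserving_fst.ae (ae_pos_expMeasure lam)] with p hp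
    rw [cellWeight]
    split_ifs with h
    · rw [Real.norm_of_nonneg (inv_nonneg.2 (by linarith))]
      exact inv_anti₀ hu (by linarith)
    · simpa using hu.le
  rw [integral_prod _ hint, integral_expMeasure hlam, ← integral_Ioi_E1 hlam hu,
    ← integral_const_mul]
  refine setIntegral_congr_fun measurableSet_Ioi fun a ha => ?_
  have ha' : 0 < a := ha
  have hinner : ∫ b, cellWeight u (a, b) ∂(expMeasure lam)
      = lam * Real.exp (lam * a) * E1 (lam * (a + u)) := by
    rw [integral_expMeasure hlam, ← integral_Ioi_exp_mul_inv_add hlam ha'.le hu,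
      ← integral_Ici_eq_integral_Ioi (x := u), ← integral_indicator measurableSet_Ioi,
      ← integral_indicator measurableSet_Ici]
    congr with b
    simp only [Set.indicator, Set.mem_Ioi, Set.mem_Ici, cellWeight]
    by_cases hb : u ≤ b
    · simp [hb, hu.trans_le hb, show -a ≤ u by linarith]
    · simp [hb]
  simp only [hinner]
  have : Real.exp (-(lam * a)) * Real.exp (lam * a) = 1 := by rw [← Real.exp_add]; simp
  rw [add_comm u a]
  linear_combination lam * lam * E1 (lam * (a + u)) * this

lemma integral_cellWeight {lam u : ℝ} (hlam : 0 < lam) (hu : u ≠ 0) :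
    ∫ p, cellWeight u p ∂((expMeasure lam).prod (expMeasure lam))
      = lam * (Real.exp (-(lam * |u|)) * hker (lam * |u|)) := by
  have := isProbabilityMeasure_expMeasure hlam
  rcases lt_or_gt_of_ne hu with h | h
  · rw [abs_of_neg h, ← integral_cellWeight_of_pos hlam (neg_pos.2 h), ← integral_prod_swap]
    congr with p
    simp only [cellWeight, Prod.fst_swap, Prod.snd_swap, neg_le_neg_iff, add_comm p.2,
      neg_le (a := p.2)]
    congr 1
    simp only [eq_iff_iff]
    constructor
    · rintro ⟨h1, h2⟩; constructor <;> linarith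
    · rintro ⟨h1, h2⟩; constructor <;> linarith
  · rw [abs_of_pos h, integral_cellWeight_of_pos hlam h]

lemma integral_pi_prod_pairs {d : ℕ} {α : Type*} [MeasurableSpace α] (μ : Measure α)
    [IsProbabilityMeasure μ] (g : Fin d → α × α → ℝ) :
    ∫ T : Fin d × Fin 2 → α, ∏ j, g j (T (j, 0), T (j, 1)) ∂(Measure.pi fun _ => μ)
      = ∏ j, ∫ p, g j p ∂(μ.prod μ) := by
  have hcurry : MeasurePreserving (MeasurableEquiv.curry (Fin d) (Fin 2) α)
      (Measure.pi fun _ => μ) (Measure.pi fun _ => Measure.pi fun _ => μ) := by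
    refine ⟨MeasurableEquiv.measurable _, ?_⟩
    simpa only [Measure.infinitePi_eq_pi] using
      Measure.infinitePi_map_curry (ι := Fin d) (κ := Fin 2) (fun _ _ => μ)
  have h := hcurry.integral_comp' (fun S => ∏ j, g j (S j 0, S j 1))
  refine h.trans ?_
  rw [integral_fintype_prod_eq_prod (fun j (t : Fin 2 → α) => g j (t 0, t 1))]
  exact Finset.prod_congr rfl fun j _ => (measurePreserving_finTwoArrow μ).integral_comp' (g j)

/-- Let `X₁, …, X_n ∈ ℝ^d` and let `{T_{j,0}, T_{j,1}}_{j ≤ d}` be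
`2d` i.i.d. rate-`λ` exponential random variables (formalized by taking the
expectation with respect to the product of `2d` copies of the exponential
distribution `expMeasure λ`).  For every `x` with `xⱼ ≠ Xᵢ⁽ʲ⁾` for all `i, j`,
the ideal (infinite) Mondrian forest density estimator satisfies
`(1/n) ∑ᵢ E[1{∀j : -T_{j,0} ≤ xⱼ - Xᵢ⁽ʲ⁾ ≤ T_{j,1}} / ∏ⱼ (T_{j,0} + T_{j,1})]
 = (λ^d/n) ∑ᵢ e^{-λ‖x - Xᵢ‖₁} ∏ⱼ h(λ|xⱼ - Xᵢ⁽ʲ⁾|)`. -/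
theorem mondrian_forest_density_estimator_eq
    {d n : ℕ} (hd : 1 ≤ d) (hn : 1 ≤ n) (lam : ℝ) (hlam : 0 < lam)
    (X : Fin n → Fin d → ℝ) (x : Fin d → ℝ)
    (hx : ∀ i j, x j ≠ X i j) :
    (1 / (n : ℝ)) * ∑ i : Fin n,
        ∫ T : Fin d × Fin 2 → ℝ,
          (if ∀ j, -T (j, 0) ≤ x j - X i j ∧ x j - X i j ≤ T (j, 1) then
            (∏ j, (T (j, 0) + T (j, 1)))⁻¹ else 0)
          ∂(Measure.pi fun _ : Fin d × Fin 2 => expMeasure lam)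
      = (lam ^ d / (n : ℝ)) * ∑ i : Fin n,
          Real.exp (-(lam * ∑ j, |x j - X i j|)) * ∏ j, hker (lam * |x j - X i j|) := by
  have := isProbabilityMeasure_expMeasure hlam
  rw [div_eq_mul_one_div (lam ^ d), mul_comm (lam ^ d), mul_assoc]
  congr 1
  rw [Finset.mul_sum]
  refine Finset.sum_congr rfl fun i _ => ?_
  have hfactor : ∀ T : Fin d × Fin 2 → ℝ,
      (if ∀ j, -T (j, 0) ≤ x j - X i j ∧ x j - X i j ≤ T (j, 1) then
        (∏ j, (T (j, 0) + T (j, 1)))⁻¹ else 0)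
      = ∏ j, cellWeight (x j - X i j) (T (j, 0), T (j, 1)) := by
    intro T
    simp only [cellWeight]
    split_ifs with h
    · rw [← Finset.prod_inv_distrib]
      exact Finset.prod_congr rfl fun j _ => (if_pos (h j)).symm
    · obtain ⟨j, hj⟩ := not_forall.1 h
      exact (Finset.prod_eq_zero (Finset.mem_univ j) (if_neg hj)).symm
  simp only [hfactor]
  rw [integral_pi_prod_pairs,
    Finset.prod_congr rfl fun j _ => integral_cellWeight hlam (sub_ne_zero.2 (hx i j)),
    Finset.prod_mul_distrib, Finset.prod_mul_distrib, ← Real.exp_sum, Finset.mul_sum,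
    ← Finset.sum_neg_distrib]
  simp
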